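/- arXiv:2011.08989 — 2 statements merged into one kernel-verified Lean document; each statement's English description precedes it below -/
import Mathlib

section
/- Let S₁ = [[0,0,1],[0,0,0],[1,0,0]], S₂ = [[0,0,0],[0,0,1],[0,1,0]], S₃ = [[0,1,0],[1,0,0],[0,0,0]]. Then for all α, β, γ ∈ ℂ, the matrix α·S₁ + β·S₂ + γ·S₃ (which equals [[0,γ,α],[γ,0,β],[α,β,0]]) does not have rank 1; that is, the net of conics of type E* contains no matrix of rank 1. -/
open Matrix

/-- The two-by-two minors of a matrix of rank at most one vanish. -/
theorem mul_eq_mul_of_rank_le_one {K m n : Type*} [Field K] [Finite m] [Fintype n]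
    {A : Matrix m n K} (h : A.rank ≤ 1) (i k : m) (j l : n) :
    A i j * A k l = A i l * A k j := by
  rw [rank_eq_finrank_span_cols, finrank_le_one_iff] at h
  obtain ⟨v, hv⟩ := h
  have key : ∀ j, ∃ c : K, ∀ i, A i j = c * v.1 i := fun j ↦ by
    obtain ⟨c, hc⟩ := hv ⟨A.col j, Submodule.subset_span ⟨j, rfl⟩⟩
    exact ⟨c, fun i ↦ (congrFun (congrArg Subtype.val hc) i).symm⟩
  obtain ⟨c, hc⟩ := key j
  obtain ⟨d, hd⟩ := key l
  rw [hc, hc, hd, hd]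
  ring

/-- A symmetric matrix with zero diagonal never has rank one. -/
theorem rank_ne_one_of_isSymm_of_diag_eq_zero {K n : Type*} [Field K] [Fintype n]
    {A : Matrix n n K} (hA : A.IsSymm) (hd : A.diag = 0) : A.rank ≠ 1 := by
  intro h
  have hzero : A = 0 := by
    ext i j
    have hm := mul_eq_mul_of_rank_le_one h.le i j j i
    rw [hA.apply i j, show A i i = 0 from congrFun hd i, zero_mul] at hm
    exact mul_self_eq_zero.mp hm
  simp [hzero] at h

/-- The net of conics of type E* contains no matrix of rank 1. -/
theorem typeEstar_no_rank_one (α β γ : ℂ) :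
    (α • (!![0,0,1;0,0,0;1,0,0] : Matrix (Fin 3) (Fin 3) ℂ)
        + β • !![0,0,0;0,0,1;0,1,0]
        + γ • !![0,1,0;1,0,0;0,0,0]).rank ≠ 1 := by
  apply rank_ne_one_of_isSymm_of_diag_eq_zero
  · ext i j
    fin_cases i <;> fin_cases j <;> simp
  · ext i
    fin_cases i <;> simp
end

section
/- Let L be the ℂ-span of E₁₁ = [[1,0,0],[0,0,0],[0,0,0]], S₂ = [[0,1,0],[1,0,0],[0,0,0]], and S₃ = [[0,0,0],[0,0,1],[0,1,0]] (a net of conics of type G*). Suppose N is a symmetric 3×3 complex matrix with trace(NM) = 0 for all M ∈ L and with N₁₂ = 0 and N₂₂ = 0, and suppose that N has rank at most 1 or that E₁₁·N = 0 (matrix product). Then N is a scalar multiple of E₃₃ = [[0,0,0],[0,0,0],[0,0,1]]. In particular, the set-theoretic ML-base locus of the type G* net consists only of the rank-one point E₃₃. -/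
/-- Minors of a matrix of size larger than its rank vanish. -/
theorem det_submatrix_eq_zero_of_rank_lt {m n p R : Type*} [Fintype n] [Fintype p]
    [DecidableEq p] [CommRing R] [IsDomain R] (A : Matrix m n R) (r : p → m) (c : p → n)
    (h : A.rank < Fintype.card p) : (A.submatrix r c).det = 0 := by
  by_contra hdet
  have hrank := Matrix.rank_of_det_ne_zero hdet
  have hle := Matrix.rank_submatrix_le A r c
  omega

/-- For the type G* net L = span{E₁₁, S₂, S₃}, a symmetric matrix N in
the polar L^⊥ lying in the span of the reciprocal surface (N₁₂ = 0 and N₂₂ = 0) which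
has rank at most 1 or is annihilated by the rank-one matrix E₁₁ of the net is a scalar
multiple of E₃₃. So the set-theoretic ML-base locus consists only of the rank-one
point E₃₃. -/
theorem typeGstar_ML_base_locus (N : Matrix (Fin 3) (Fin 3) ℂ)
    (hsym : N.IsSymm)
    (hpolar : ∀ M ∈ Submodule.span ℂ
        ({!![1,0,0;0,0,0;0,0,0], !![0,1,0;1,0,0;0,0,0], !![0,0,0;0,0,1;0,1,0]} :
          Set (Matrix (Fin 3) (Fin 3) ℂ)), (N * M).trace = 0)
    (h1 : N 0 1 = 0) (h2 : N 1 1 = 0)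
    (hX : N.rank ≤ 1 ∨ (!![1,0,0;0,0,0;0,0,0] : Matrix (Fin 3) (Fin 3) ℂ) * N = 0) :
    ∃ t : ℂ, N = t • !![0,0,0;0,0,0;0,0,1] := by
  have trace_zero (M) (hM : M ∈ ({!![1,0,0;0,0,0;0,0,0], !![0,1,0;1,0,0;0,0,0],
      !![0,0,0;0,0,1;0,1,0]} : Set (Matrix (Fin 3) (Fin 3) ℂ))) : (N * M).trace = 0 :=
    hpolar M (Submodule.subset_span hM)
  have h00 : N 0 0 = 0 := by
    simpa [Matrix.trace, Matrix.mul_apply, Fin.sum_univ_three] using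
      trace_zero !![1,0,0;0,0,0;0,0,0] (by simp)
  have h12 : N 1 2 = 0 := by
    have h := trace_zero !![0,0,0;0,0,1;0,1,0] (by simp)
    simp only [Matrix.trace, Matrix.diag, Matrix.mul_apply, Fin.sum_univ_three] at h
    simpa [hsym.apply 1 2] using h
  have h02 : N 0 2 = 0 := by
    rcases hX with hX | hX
    · have h := det_submatrix_eq_zero_of_rank_lt N ![0, 2] ![0, 2]
        (hX.trans_lt (by simp))
      rw [Matrix.det_fin_two] at h
      simpa [h00, hsym.apply 0 2] using h
    · simpa [Matrix.mul_apply, Fin.sum_univ_three] using congrFun (congrFun hX 0) 2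
  refine ⟨N 2 2, ?_⟩
  ext i j
  fin_cases i <;> fin_cases j <;>
    simp [h00, h1, h2, h02, h12, hsym.apply 0 1, hsym.apply 0 2, hsym.apply 1 2]
end
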